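/- Let σ > 0 and let μ be the Gaussian law N(m, σ²) on ℝ. For every rate R ≥ 0, every blocklength n ≥ 1, and every code consisting of a measurable encoder f : ℝⁿ → Fin M with M ≤ 2^(nR) codewords and a decoder g : Fin M → ℝⁿ, the expected per-symbol squared-error distortion of the code on n i.i.d. samples from μ satisfies E[(1/n) Σ_{i=1}^n (X_i − (g(f(X)))_i)²] ≥ σ² · 2^(−2R), where X = (X_1, …, X_n) has law μ^⊗n. (Converse part of the rate-distortion theorem for the memoryless Gaussian scalar source.) -/

import Mathlib

open MeasureTheory ProbabilityTheory

/-- Expected per-symbol squared-error distortion of a blocklength-`n` code `(f, g)`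
with `M` codewords on a source with i.i.d. components of law `μ`. -/
noncomputable def expectedDistortion (n M : ℕ) (μ : Measure ℝ)
    (f : (Fin n → ℝ) → Fin M) (g : Fin M → (Fin n → ℝ)) : ℝ :=
  ∫ x, (1 / (n : ℝ)) * ∑ i, (x i - g (f x) i) ^ 2 ∂(Measure.pi fun _ : Fin n => μ)

lemma grd_pdf_mul (m σ D a : ℝ) (hσ : 0 < σ) (t : ℝ) :
    gaussianPDFReal m (Real.toNNReal (σ ^ 2)) t *
      Real.exp ((t - m) ^ 2 / (2 * σ ^ 2) - (t - a) ^ 2 / (2 * D)) =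
    (√(2 * Real.pi * σ ^ 2))⁻¹ * Real.exp (-(1 / (2 * D)) * (t - a) ^ 2) := by
  have hv : ((Real.toNNReal (σ ^ 2) : NNReal) : ℝ) = σ ^ 2 := Real.coe_toNNReal _ (by positivity)
  rw [gaussianPDFReal, hv, mul_assoc, ← Real.exp_add]
  congr 2
  ring

lemma grd_one (m σ D a : ℝ) (hσ : 0 < σ) (hD : 0 < D) :
    Integrable (fun t => Real.exp ((t - m) ^ 2 / (2 * σ ^ 2) - (t - a) ^ 2 / (2 * D)))
      (gaussianReal m (Real.toNNReal (σ ^ 2))) ∧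
    ∫ t, Real.exp ((t - m) ^ 2 / (2 * σ ^ 2) - (t - a) ^ 2 / (2 * D))
      ∂(gaussianReal m (Real.toNNReal (σ ^ 2))) = √D / σ := by
  have hv0 : Real.toNNReal (σ ^ 2) ≠ 0 := by
    simpa using hσ.ne'
  constructor
  · rw [gaussianReal_of_var_ne_zero _ hv0,
      integrable_withDensity_iff_integrable_smul' (measurable_gaussianPDF _ _)
        (Filter.Eventually.of_forall fun _ => gaussianPDF_lt_top)]
    simp only [toReal_gaussianPDF, smul_eq_mul, grd_pdf_mul m σ D a hσ]
    have := (integrable_exp_neg_mul_sq (b := 1 / (2 * D)) (by positivity)).comp_sub_right a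
    exact this.const_mul _
  · rw [integral_gaussianReal_eq_integral_smul hv0]
    simp only [smul_eq_mul, grd_pdf_mul m σ D a hσ]
    rw [integral_const_mul,
      integral_sub_right_eq_self (fun t => Real.exp (-(1 / (2 * D)) * t ^ 2)) a,
      integral_gaussian]
    have h1 : Real.pi / (1 / (2 * D)) = (2 * Real.pi) * D := by field_simp
    have hp : 0 < √(2 * Real.pi) := Real.sqrt_pos.2 (by positivity)
    rw [h1, Real.sqrt_mul (x := 2 * Real.pi) (by positivity) (σ ^ 2),
      Real.sqrt_mul (x := 2 * Real.pi) (by positivity) D, Real.sqrt_sq hσ.le]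
    field_simp

lemma grd_sq (m σ : ℝ) :
    Integrable (fun t => (t - m) ^ 2) (gaussianReal m (Real.toNNReal (σ ^ 2))) ∧
    ∫ t, (t - m) ^ 2 ∂(gaussianReal m (Real.toNNReal (σ ^ 2))) = σ ^ 2 := by
  constructor
  · have h := (memLp_id_gaussianReal (μ := m) (v := Real.toNNReal (σ ^ 2)) 2).sub
      (memLp_const m)
    exact h.integrable_sq
  · have h := variance_fun_id_gaussianReal (μ := m) (v := Real.toNNReal (σ ^ 2))
    rw [variance_eq_integral measurable_id'.aemeasurable] at h
    simp only [integral_id_gaussianReal] at h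
    rw [h, Real.coe_toNNReal _ (by positivity)]

/-- Converse part of the rate-distortion theorem for the memoryless Gaussian
scalar source: any blocklength-`n` code with at most `2 ^ (n * R)` codewords has
expected per-symbol squared-error distortion at least `σ² * 2 ^ (-2R)`. -/
theorem gaussian_rate_distortion_converse
    (m σ : ℝ) (hσ : 0 < σ)
    (μ : Measure ℝ) (hμ : μ = gaussianReal m (Real.toNNReal (σ ^ 2)))
    (R : ℝ) (hR : 0 ≤ R) (n : ℕ) (hn : 1 ≤ n)
    (M : ℕ) (hM : (M : ℝ) ≤ 2 ^ ((n : ℝ) * R))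
    (f : (Fin n → ℝ) → Fin M) (hf : Measurable f)
    (g : Fin M → (Fin n → ℝ)) :
    σ ^ 2 * 2 ^ (-(2 * R)) ≤ expectedDistortion n M μ f g := by
  have hn0 : (0 : ℝ) < n := by exact_mod_cast hn
  have : IsProbabilityMeasure μ := by rw [hμ]; infer_instance
  obtain ⟨hsqI, hsq⟩ := grd_sq m σ
  rw [← hμ] at hsqI hsq
  set P : Measure (Fin n → ℝ) := Measure.pi fun _ : Fin n => μ with hP
  have hgf : ∀ i, Measurable fun x => g (f x) i := fun i =>
    (measurable_of_countable (fun k => g k i)).comp hf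
  have hAi : ∀ i, Integrable (fun x : Fin n → ℝ => (x i - m) ^ 2) P := fun i =>
    integrable_comp_eval (μ := fun _ : Fin n => μ) (i := i) hsqI
  have hdi : ∀ i, Integrable (fun x : Fin n → ℝ => (x i - g (f x) i) ^ 2) P := by
    intro i
    refine Integrable.mono' (((hAi i).const_mul 2).add
      (integrable_const (2 * ∑ k, (m - g k i) ^ 2)))
      (((measurable_pi_apply i).sub (hgf i)).pow_const 2).aestronglyMeasurable
      (Filter.Eventually.of_forall fun x => ?_)
    have h1 : (m - g (f x) i) ^ 2 ≤ ∑ k, (m - g k i) ^ 2 :=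
      Finset.single_le_sum (f := fun k => (m - g k i) ^ 2)
        (fun k _ => sq_nonneg _) (Finset.mem_univ (f x))
    rw [Real.norm_of_nonneg (sq_nonneg _)]
    simp only [Pi.add_apply]
    nlinarith [sq_nonneg ((x i - m) - (m - g (f x) i))]
  have hE : ∫ x, ∑ i, (x i - g (f x) i) ^ 2 ∂P = n * expectedDistortion n M μ f g := by
    rw [expectedDistortion, integral_const_mul, ← hP]
    field_simp
  have hE0 : 0 ≤ expectedDistortion n M μ f g :=
    integral_nonneg fun x => by positivity
  have hA : ∫ x, ∑ i, (x i - m) ^ 2 ∂P = n * σ ^ 2 := by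
    rw [integral_finsetSum _ (fun i _ => hAi i)]
    have : ∀ i, ∫ x : Fin n → ℝ, (x i - m) ^ 2 ∂P = σ ^ 2 := fun i => by
      rw [hP, integral_comp_eval (μ := fun _ : Fin n => μ) (i := i)
        (f := fun t : ℝ => (t - m) ^ 2) hsqI.aestronglyMeasurable, hsq]
    simp [this]
  refine le_of_forall_gt_imp_ge_of_dense fun D hD => ?_
  have hD0 : 0 < D := lt_of_le_of_lt hE0 hD
  have hone : ∀ a, _ := fun a => grd_one m σ D a hσ hD0
  rw [← hμ] at hone
  let q : ℝ → ℝ → ℝ := fun a t => (t - m) ^ 2 / (2 * σ ^ 2) - (t - a) ^ 2 / (2 * D)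
  let h : (Fin n → ℝ) → ℝ := fun x => ∑ i, q (g (f x) i) (x i)
  have hh : ∀ x, h x = (∑ i, (x i - m) ^ 2) / (2 * σ ^ 2)
      - (∑ i, (x i - g (f x) i) ^ 2) / (2 * D) := fun x => by
    simp only [h, q, Finset.sum_sub_distrib, Finset.sum_div]
  have hAI := (integrable_finsetSum Finset.univ (fun i _ => hAi i)).div_const (2 * σ ^ 2)
  have hdI := (integrable_finsetSum Finset.univ (fun i _ => hdi i)).div_const (2 * D)
  have hhI : Integrable h P := by
    rw [funext hh]; exact hAI.sub hdI
  have hh0 : 0 ≤ ∫ x, h x ∂P := by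
    simp only [hh]
    rw [integral_sub hAI hdI, integral_div, integral_div, hA, hE, sub_nonneg,
      div_le_div_iff₀ (by positivity) (by positivity)]
    have : 0 < (n : ℝ) * σ ^ 2 := by positivity
    nlinarith
  let G : Fin M → (Fin n → ℝ) → ℝ := fun k x => ∏ i, Real.exp (q (g k i) (x i))
  have hGI : ∀ k, Integrable (G k) P := fun k =>
    Integrable.fintype_prod (f := fun i t => Real.exp (q (g k i) t)) (fun i => (hone (g k i)).1)
  have hG : ∀ k, ∫ x, G k x ∂P = (√D / σ) ^ n := fun k => by
    rw [hP, integral_fintype_prod_eq_prod (fun i t => Real.exp (q (g k i) t))]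
    rw [Finset.prod_congr rfl fun i _ => (hone (g k i)).2]
    simp [div_pow]
  have hpt : ∀ x, 1 + h x ≤ ∑ k, G k x := fun x => by
    have h1 : G (f x) x ≤ ∑ k, G k x :=
      Finset.single_le_sum (f := fun k => G k x)
        (fun k _ => Finset.prod_nonneg fun i _ => (Real.exp_pos _).le) (Finset.mem_univ (f x))
    have h2 : G (f x) x = Real.exp (h x) := (Real.exp_sum _ _).symm
    linarith [Real.add_one_le_exp (h x)]
  have hkey : 1 ≤ M * (√D / σ) ^ n := by
    have h1 := integral_mono ((integrable_const (1 : ℝ)).add hhI)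
      (integrable_finsetSum Finset.univ (fun k _ => hGI k)) hpt
    rw [integral_finsetSum _ (fun k _ => hGI k)] at h1
    have h2 : ∫ x, ((fun _ => (1 : ℝ)) + h : (Fin n → ℝ) → ℝ) x ∂P = 1 + ∫ x, h x ∂P := by
      simp only [Pi.add_apply]
      rw [integral_add (integrable_const _) hhI]; simp
    rw [h2] at h1
    simp only [hG, Finset.sum_const, Finset.card_univ, Fintype.card_fin, nsmul_eq_mul] at h1
    linarith
  have hr : 0 ≤ √D / σ := by positivity
  have hk2 : 1 ≤ ((2 : ℝ) ^ R * (√D / σ)) ^ n := by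
    rw [mul_pow, ← Real.rpow_natCast ((2 : ℝ) ^ R), ← Real.rpow_mul (by norm_num), mul_comm R]
    exact hkey.trans (mul_le_mul_of_nonneg_right hM (by positivity))
  have hk3 : 1 ≤ (2 : ℝ) ^ R * (√D / σ) :=
    (one_le_pow_iff_of_nonneg (by positivity) (by omega)).1 hk2
  have hk4 : 1 ≤ ((2 : ℝ) ^ R * (√D / σ)) ^ 2 := one_le_pow₀ hk3
  rw [mul_pow, div_pow, Real.sq_sqrt hD0.le] at hk4
  have h5 : (2 : ℝ) ^ (-(2 * R)) = (((2 : ℝ) ^ R) ^ 2)⁻¹ := by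
    rw [Real.rpow_neg (by norm_num), ← Real.rpow_natCast ((2 : ℝ) ^ R),
      ← Real.rpow_mul (by norm_num), mul_comm R]; norm_num
  have hp : 0 < ((2 : ℝ) ^ R) ^ 2 := by positivity
  rw [h5, ← div_eq_mul_inv, div_le_iff₀ hp]
  rw [← mul_div_assoc, le_div_iff₀ (by positivity)] at hk4
  linarith
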